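/- arXiv:2003.14156 — 6 statements merged into one kernel-verified Lean document; each statement's English description precedes it below -/
import Mathlib

section
/- Let p be a prime and A a commutative ring of characteristic p. Suppose α, β : ℕ → A satisfy: (α_0 − 1)² = 0, α_0·β_0 = 1, and Σ_{k=0}^{i} (α_{i−k})^(p^k) · β_k = 0 for every integer i ≥ 1. Then β_0 = 2 − α_0, and for every n ≥ 1, β_n = β_0 · Σ_{ν ∈ Part(n)} (−1)^(ℓ(ν)) · Π_{j=1}^{ℓ(ν)} (α_{ν(j)})^(p^(σ(ν)(j))). -/
namespace Composition

/-- A product over the blocks of a composition, written with the list of blocks. -/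
theorem prod_blocksFun_sizeUpTo {M : Type*} [CommMonoid M] (f : ℕ → ℕ → M) {n : ℕ}
    (ν : Composition n) :
    ∏ j : Fin ν.length, f (ν.blocksFun j) (ν.sizeUpTo j) =
      ∏ j ∈ Finset.range ν.blocks.length, f (ν.blocks.getD j 0) (ν.blocks.take j).sum := by
  rw [Finset.prod_range]
  refine Finset.prod_congr rfl fun j _ => ?_
  simp [blocksFun, sizeUpTo]

/-- Split off the last block in a product over the blocks of a composition. -/
theorem prod_blocksFun_sizeUpTo_of_blocks_eq_append {M : Type*} [CommMonoid M] (f : ℕ → ℕ → M)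
    {n k a : ℕ} (ν : Composition n) (μ : Composition k) (h : ν.blocks = μ.blocks ++ [a]) :
    ∏ j : Fin ν.length, f (ν.blocksFun j) (ν.sizeUpTo j) =
      f a k * ∏ j : Fin μ.length, f (μ.blocksFun j) (μ.sizeUpTo j) := by
  rw [prod_blocksFun_sizeUpTo, prod_blocksFun_sizeUpTo, h, List.length_append,
    List.length_singleton, Finset.prod_range_succ, mul_comm]
  congr 1
  · simp
  · refine Finset.prod_congr rfl fun j hj => ?_
    rw [Finset.mem_range] at hj
    rw [List.getD_append _ _ _ _ hj, List.take_append_of_le_length hj.le]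

/-- Recursion on the last block for sums over compositions of products over blocks. -/
theorem sum_prod_blocksFun_sizeUpTo {R : Type*} [CommSemiring R] (f : ℕ → ℕ → R) {n : ℕ}
    (hn : 1 ≤ n) :
    ∑ ν : Composition n, ∏ j : Fin ν.length, f (ν.blocksFun j) (ν.sizeUpTo j) =
      ∑ k ∈ Finset.range n, f (n - k) k *
        ∑ μ : Composition k, ∏ j : Fin μ.length, f (μ.blocksFun j) (μ.sizeUpTo j) := by
  simp_rw [Finset.mul_sum]
  rw [Finset.sum_sigma']
  symm
  have lt_of_mem {x : Σ k, Composition k}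
      (hx : x ∈ (Finset.range n).sigma fun k => (Finset.univ : Finset (Composition k))) :
      x.1 < n := by simpa using hx
  refine Finset.sum_bij
    (fun x hx => (x.2.append (single (n - x.1) (Nat.sub_pos_of_lt (lt_of_mem hx)))).cast
      (Nat.add_sub_of_le (lt_of_mem hx).le)) (fun _ _ => Finset.mem_univ _) ?_ ?_ ?_
  · intro x hx y hy h
    have h' : x.2.blocks ++ [n - x.1] = y.2.blocks ++ [n - y.1] := congrArg blocks h
    exact sigma_eq_iff_blocks_eq.2 (List.append_inj' h' rfl).1
  · intro ν _
    have hν : ν.blocks ≠ [] := by rw [Ne, blocks_eq_nil]; lia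
    have hb := List.dropLast_append_getLast hν
    have hsum : ν.blocks.dropLast.sum + ν.blocks.getLast hν = n := by
      simpa [hb, ν.blocks_sum] using
        (List.sum_append (l₁ := ν.blocks.dropLast) (l₂ := [ν.blocks.getLast hν])).symm
    have hpos : 0 < ν.blocks.getLast hν := ν.blocks_pos (List.getLast_mem hν)
    refine ⟨⟨ν.blocks.dropLast.sum, ν.blocks.dropLast,
      fun hi => ν.blocks_pos (List.mem_of_mem_dropLast hi), rfl⟩, ?_, ?_⟩
    · simp only [Finset.mem_sigma, Finset.mem_range, Finset.mem_univ, and_true]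
      lia
    · ext1
      change ν.blocks.dropLast ++ [n - ν.blocks.dropLast.sum] = ν.blocks
      rw [← Nat.eq_sub_of_add_eq' hsum, hb]
  · intro x hx
    exact (prod_blocksFun_sizeUpTo_of_blocks_eq_append f _ x.2 rfl).symm

end Composition

/-- Milnor's conjugation formula, coefficientwise.  Let `p` be a prime
and `A` a commutative ring of characteristic `p`.  Suppose `α β : ℕ → A` satisfy
`(α 0 - 1)² = 0`, `α 0 * β 0 = 1` and `∑_{k=0}^{i} (α_{i−k})^(p^k) · β_k = 0` for all
`i ≥ 1`.  Then `β 0 = 2 - α 0` and, for every `n ≥ 1`,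
`β n = β 0 * ∑_{ν ∈ Part(n)} (−1)^(ℓ(ν)) * ∏_{j=1}^{ℓ(ν)} (α_{ν(j)})^(p^(σ(ν)(j)))`,
where `Part(n)` is the set of ordered partitions (compositions) of `n`, `ℓ(ν)` is the
length and `σ(ν)(j) = ν(1) + ⋯ + ν(j−1)`. -/
theorem milnor_conjugation_formula {A : Type*} [CommRing A] (p : ℕ) (hp : p.Prime)
    [CharP A p] (α β : ℕ → A)
    (h0 : (α 0 - 1) ^ 2 = 0)
    (h1 : α 0 * β 0 = 1)
    (h2 : ∀ i : ℕ, 1 ≤ i → ∑ k ∈ Finset.range (i + 1), α (i - k) ^ p ^ k * β k = 0) :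
    β 0 = 2 - α 0 ∧
    ∀ n : ℕ, 1 ≤ n →
      β n = β 0 * ∑ ν : Composition n, (-1 : A) ^ ν.length *
        ∏ j : Fin ν.length, α (ν.blocksFun j) ^ p ^ ν.sizeUpTo j := by
  have hβ : β 0 = 2 - α 0 := by linear_combination (2 - α 0) * h1 + β 0 * h0
  refine ⟨hβ, ?_⟩
  have : Fact p.Prime := ⟨hp⟩
  have hα (i : ℕ) (hi : 1 ≤ i) : α 0 ^ p ^ i = 1 := by
    have hpi : 2 ≤ p ^ i := hp.two_le.trans (Nat.le_self_pow (by lia) p)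
    have h := sub_pow_char_pow (p := p) (n := i) (α 0) 1
    rw [pow_eq_zero_of_le hpi h0, one_pow] at h
    exact sub_eq_zero.1 h.symm
  set f : ℕ → ℕ → A := fun a s => -α a ^ p ^ s with hf
  have hsign (n : ℕ) : ∑ ν : Composition n, (-1 : A) ^ ν.length *
      ∏ j : Fin ν.length, α (ν.blocksFun j) ^ p ^ ν.sizeUpTo j =
      ∑ ν : Composition n, ∏ j : Fin ν.length, f (ν.blocksFun j) (ν.sizeUpTo j) := by
    simp [hf, Finset.prod_neg]
  simp_rw [hsign]
  suffices h : ∀ n, β n = β 0 * ∑ ν : Composition n,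
      ∏ j : Fin ν.length, f (ν.blocksFun j) (ν.sizeUpTo j) from fun n _ => h n
  intro n
  induction n using Nat.strong_induction_on with
  | _ n ih =>
    rcases Nat.eq_zero_or_pos n with rfl | hn
    · have hlen (ν : Composition 0) :
          ∏ j : Fin ν.length, f (ν.blocksFun j) (ν.sizeUpTo j) = 1 := by
        rw [Composition.prod_blocksFun_sizeUpTo, ν.blocks_eq_nil.2 rfl]
        simp
      simp [hlen, composition_card]
    · have h := h2 n hn
      rw [Finset.sum_range_succ, Nat.sub_self, hα n hn, one_mul] at h
      rw [Composition.sum_prod_blocksFun_sizeUpTo f hn, Finset.mul_sum,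
        eq_neg_of_add_eq_zero_right h, ← Finset.sum_neg_distrib]
      refine Finset.sum_congr rfl fun k hk => ?_
      rw [ih k (Finset.mem_range.1 hk)]
      simp only [hf]
      ring
end

section
/- Let p be a prime, A a commutative ring of characteristic p, and α : ℕ → A a sequence with (α_0 − 1)² = 0. Define ᾱ : ℕ → A by ᾱ_0 = 2 − α_0 and, for n ≥ 1, ᾱ_n = ᾱ_0 · Σ_{ν ∈ Part(n)} (−1)^(ℓ(ν)) · Π_{j=1}^{ℓ(ν)} (α_{ν(j)})^(p^(σ(ν)(j))). Then (ᾱ_0 − 1)² = 0 and ᾱ is a two-sided inverse of α for the product: α·ᾱ = δ and ᾱ·α = δ. Equivalently, ᾱ gives the compositional inverse of the power series Σ_{i≥0} α_i X^(p^i). -/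
/-- The product of two coefficient sequences, encoding substitution of the power series
`∑_{j≥0} α_j X^(p^j)` into `∑_{i≥0} β_i X^(p^i)`:
`(α·β)_i = ∑_{j=0}^{i} (α_{i−j})^(p^j) · β_j`. -/
def seqMul {A : Type*} [CommRing A] (p : ℕ) (α β : ℕ → A) : ℕ → A :=
  fun i => ∑ j ∈ Finset.range (i + 1), α (i - j) ^ p ^ j * β j

/-- The identity sequence `δ`, with `δ_0 = 1` and `δ_i = 0` for `i ≥ 1`. -/
def seqOne {A : Type*} [CommRing A] : ℕ → A :=
  fun i => if i = 0 then 1 else 0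

/-- Milnor's inversion formula: `ᾱ_0 = 2 − α_0` and, for `n ≥ 1`,
`ᾱ_n = ᾱ_0 · ∑_{ν ∈ Part(n)} (−1)^(ℓ(ν)) · ∏_{j=1}^{ℓ(ν)} (α_{ν(j)})^(p^(σ(ν)(j)))`,
the sum being over all ordered partitions (compositions) of `n`. -/
def milnorInv {A : Type*} [CommRing A] (p : ℕ) (α : ℕ → A) : ℕ → A
  | 0 => 2 - α 0
  | n + 1 =>
      (2 - α 0) * ∑ ν : Composition (n + 1), (-1 : A) ^ ν.length *
        ∏ j : Fin ν.length, α (ν.blocksFun j) ^ p ^ ν.sizeUpTo j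

/-- The summand of Milnor's inversion formula attached to a list of parts, sign included. -/
def milnorWeight {A : Type*} [CommRing A] (p : ℕ) (α : ℕ → A) : List ℕ → A
  | [] => 1
  | b :: l => -α b * milnorWeight p α l ^ p ^ b

/-- The sum over all ordered partitions of `n` in Milnor's inversion formula. -/
def milnorSum {A : Type*} [CommRing A] (p : ℕ) (α : ℕ → A) (n : ℕ) : A :=
  ∑ ν : Composition n, milnorWeight p α ν.blocks

theorem milnorWeight_eq_prod {A : Type*} [CommRing A] (p : ℕ) [Fact p.Prime] [CharP A p]
    (α : ℕ → A) (l : List ℕ) :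
    milnorWeight p α l =
      (-1) ^ l.length * ∏ j : Fin l.length, α (l.get j) ^ p ^ (l.take j).sum := by
  induction l with
  | nil => simp [milnorWeight]
  | cons b l ih =>
    have hneg : ((-1 : A) ^ l.length) ^ p ^ b = (-1) ^ l.length := by
      rw [← pow_mul, mul_comm, pow_mul, neg_one_pow_char_pow]
    have hprod : ∏ j : Fin (b :: l).length,
        α ((b :: l).get j) ^ p ^ ((b :: l).take j).sum =
        α b * (∏ j : Fin l.length, α (l.get j) ^ p ^ (l.take j).sum) ^ p ^ b := by
      rw [← Finset.prod_pow]
      refine (Fin.prod_univ_succ _).trans ?_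
      simp [pow_add, pow_mul, pow_right_comm]
    rw [milnorWeight, ih, hprod, mul_pow, hneg, List.length_cons, pow_succ]
    ring

theorem milnorInv_eq_mul_milnorSum {A : Type*} [CommRing A] (p : ℕ) [Fact p.Prime] [CharP A p]
    (α : ℕ → A) (n : ℕ) : milnorInv p α n = (2 - α 0) * milnorSum p α n := by
  cases n with
  | zero =>
    have hnil (ν : Composition 0) : ν.blocks = [] := ν.blocks_eq_nil.2 rfl
    simp [milnorInv, milnorSum, hnil, milnorWeight, composition_card]
  | succ n =>
    simp only [milnorSum, milnorWeight_eq_prod]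
    rfl

/-- Sums over ordered partitions of `n + 1`, grouped by the first part. -/
theorem Composition.sum_blocks_succ {M : Type*} [AddCommMonoid M] (f : List ℕ → M) (n : ℕ) :
    ∑ ν : Composition (n + 1), f ν.blocks =
      ∑ i : Fin (n + 1), ∑ μ : Composition (n - i), f ((i + 1) :: μ.blocks) := by
  rw [← Fintype.sum_sigma']
  symm
  refine Fintype.sum_bijective
    (fun x : (i : Fin (n + 1)) × Composition (n - i) =>
      (⟨(x.1 + 1) :: x.2.blocks, fun {i} hi => by
          rcases List.mem_cons.1 hi with rfl | hi
          · omega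
          · exact x.2.blocks_pos hi,
        by have := x.1.2; simp only [List.sum_cons, x.2.blocks_sum]; omega⟩ :
        Composition (n + 1))) ⟨?_, ?_⟩ _ _ (fun _ => rfl)
  · rintro ⟨i, μ⟩ ⟨j, ν⟩ h
    have h' := congrArg Composition.blocks h
    simp only [List.cons.injEq, add_left_inj] at h'
    obtain rfl := Fin.ext h'.1
    rw [Composition.ext h'.2]
  · rintro ⟨_ | ⟨b, l⟩, hpos, hsum⟩
    · simp at hsum
    · have hb : 0 < b := hpos (by simp)
      rw [List.sum_cons] at hsum
      refine ⟨⟨⟨b - 1, by omega⟩, ⟨l, fun hi => hpos (List.mem_cons_of_mem _ hi), ?_⟩⟩, ?_⟩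
      · dsimp only
        omega
      · ext1
        simp [Nat.sub_add_cancel hb]

theorem milnorSum_succ {A : Type*} [CommRing A] (p : ℕ) [Fact p.Prime] [CharP A p]
    (α : ℕ → A) (n : ℕ) :
    milnorSum p α (n + 1) =
      -∑ j ∈ Finset.range (n + 1), milnorSum p α (n - j) ^ p ^ (j + 1) * α (j + 1) := by
  rw [milnorSum, Composition.sum_blocks_succ, Finset.sum_range, ← Finset.sum_neg_distrib]
  refine Finset.sum_congr rfl fun i _ => ?_
  simp only [milnorSum, milnorWeight]
  rw [sum_pow_char_pow, ← Finset.mul_sum]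
  ring

theorem sub_one_sq_two_sub {A : Type*} [CommRing A] {a : A} (h : (a - 1) ^ 2 = 0) :
    (2 - a - 1) ^ 2 = 0 := by
  linear_combination h

theorem pow_char_pow_succ_eq_one {A : Type*} [CommRing A] (p : ℕ) [Fact p.Prime] [CharP A p]
    {a : A} (h : (a - 1) ^ 2 = 0) (j : ℕ) : a ^ p ^ (j + 1) = 1 := by
  have hp : 2 ≤ p := (Fact.out : p.Prime).two_le
  have hle : 2 ≤ p ^ (j + 1) := hp.trans (Nat.le_self_pow j.succ_ne_zero p)
  have hsub : (a - 1) ^ p ^ (j + 1) = a ^ p ^ (j + 1) - 1 := by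
    rw [sub_pow_char_pow, one_pow]
  rw [← sub_eq_zero, ← hsub]
  exact pow_eq_zero_of_le hle h

theorem milnorInv_seqMul {A : Type*} [CommRing A] (p : ℕ) [Fact p.Prime] [CharP A p]
    (α : ℕ → A) (h0 : (α 0 - 1) ^ 2 = 0) : seqMul p (milnorInv p α) α = seqOne := by
  have hinv : (2 - α 0) * α 0 = 1 := by linear_combination -h0
  funext n
  cases n with
  | zero => simp [seqMul, seqOne, milnorInv, hinv]
  | succ n =>
    have hpow := pow_char_pow_succ_eq_one p (sub_one_sq_two_sub h0)
    simp only [seqMul, seqOne, Finset.sum_range_succ' _ (n + 1), milnorInv_eq_mul_milnorSum,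
      mul_pow, hpow, Nat.add_sub_add_right, one_mul, pow_zero, pow_one, Nat.sub_zero,
      Nat.succ_ne_zero, if_false, milnorSum_succ]
    linear_combination (-∑ j ∈ Finset.range (n + 1),
      milnorSum p α (n - j) ^ p ^ (j + 1) * α (j + 1)) * hinv

theorem seqMul_eq_sum_antidiagonal {A : Type*} [CommRing A] (p : ℕ) (α β : ℕ → A) (n : ℕ) :
    seqMul p α β n = ∑ x ∈ Finset.HasAntidiagonal.antidiagonal n, α x.2 ^ p ^ x.1 * β x.1 :=
  (Finset.Nat.sum_antidiagonal_eq_sum_range_succ (fun j i => α i ^ p ^ j * β j) n).symm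

theorem seqMul_assoc {A : Type*} [CommRing A] (p : ℕ) [Fact p.Prime] [CharP A p]
    (α β γ : ℕ → A) : seqMul p (seqMul p α β) γ = seqMul p α (seqMul p β γ) := by
  funext n
  simp only [seqMul_eq_sum_antidiagonal, sum_pow_char_pow, Finset.sum_mul, Finset.mul_sum]
  rw [Finset.sum_sigma', Finset.sum_sigma']
  refine Finset.sum_bij'
    (fun x _ => ⟨(x.1.1 + x.2.1, x.2.2), (x.1.1, x.2.1)⟩)
    (fun x _ => ⟨(x.2.1, x.2.2 + x.1.2), (x.2.2, x.1.2)⟩) ?_ ?_ ?_ ?_ ?_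
  · rintro ⟨⟨l, m⟩, ⟨k, i⟩⟩ h
    simp only [Finset.mem_sigma, Finset.HasAntidiagonal.mem_antidiagonal, and_true] at h ⊢
    omega
  · rintro ⟨⟨j, i⟩, ⟨l, k⟩⟩ h
    simp only [Finset.mem_sigma, Finset.HasAntidiagonal.mem_antidiagonal, and_true] at h ⊢
    omega
  · rintro ⟨⟨l, m⟩, ⟨k, i⟩⟩ h
    simp only [Finset.mem_sigma, Finset.HasAntidiagonal.mem_antidiagonal] at h
    obtain ⟨-, rfl⟩ := h
    rfl
  · rintro ⟨⟨j, i⟩, ⟨l, k⟩⟩ h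
    simp only [Finset.mem_sigma, Finset.HasAntidiagonal.mem_antidiagonal] at h
    obtain ⟨-, rfl⟩ := h
    rfl
  · rintro ⟨⟨l, m⟩, ⟨k, i⟩⟩ -
    simp only [mul_pow, pow_add, pow_mul, pow_right_comm, mul_assoc]

theorem seqOne_seqMul {A : Type*} [CommRing A] (p : ℕ) [Fact p.Prime] (α : ℕ → A) :
    seqMul p seqOne α = α := by
  have hp : p ≠ 0 := (Fact.out : p.Prime).ne_zero
  funext n
  rw [seqMul, Finset.sum_range_succ, Finset.sum_eq_zero]
  · simp [seqOne]
  · intro j hj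
    have hj' : n - j ≠ 0 := by have := Finset.mem_range.1 hj; omega
    simp [seqOne, hj', hp]

theorem seqMul_seqOne {A : Type*} [CommRing A] (p : ℕ) (α : ℕ → A) :
    seqMul p α seqOne = α := by
  funext n
  simp [seqMul, seqOne]

/-- Let `p` be a prime, `A` a commutative ring of characteristic `p`
and `α : ℕ → A` a sequence with `(α 0 - 1)² = 0`.  Then the sequence `ᾱ` given by
Milnor's inversion formula satisfies `(ᾱ 0 - 1)² = 0` and is a two-sided inverse of `α`
for the product `(α·β)_i = ∑_{j=0}^{i} (α_{i−j})^(p^j) · β_j`, i.e. `α·ᾱ = δ` and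
`ᾱ·α = δ`. -/
theorem milnorInv_two_sided_inverse {A : Type*} [CommRing A] (p : ℕ) (hp : p.Prime)
    [CharP A p] (α : ℕ → A) (h0 : (α 0 - 1) ^ 2 = 0) :
    (milnorInv p α 0 - 1) ^ 2 = 0 ∧
    seqMul p α (milnorInv p α) = seqOne ∧
    seqMul p (milnorInv p α) α = seqOne := by
  have : Fact p.Prime := ⟨hp⟩
  have h0' : (milnorInv p α 0 - 1) ^ 2 = 0 := sub_one_sq_two_sub h0
  have hleft := milnorInv_seqMul p α h0
  have hleft' := milnorInv_seqMul p (milnorInv p α) h0'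
  refine ⟨h0', ?_, hleft⟩
  have hα : milnorInv p (milnorInv p α) = α := by
    rw [← seqMul_seqOne p (milnorInv p (milnorInv p α)), ← hleft, ← seqMul_assoc, hleft',
      seqOne_seqMul]
  rwa [hα] at hleft'
end

section
/- Let α, β ∈ G_p(A,I), let ᾱ and β̄ be their inverses in G_p(A,I) (so α·ᾱ = ᾱ·α = δ and β·β̄ = β̄·β = δ), and let γ = (ᾱ·β̄)·(α·β) be their commutator. Then γ_0 = 1, γ_1 = α_1(β_0 − 1) + (1 − α_0)β_1, and γ_2 = (α_2 − α_1^(p+1))(β_0 − 1) + (1 − α_0)(β_2 − β_1^(p+1)) + α_0·α_1^p·β_1 − α_1·β_0·β_1^p. -/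
/-- `I` is a square-zero ideal: `x·y = 0` for all `x, y ∈ I`. -/
def IsSqZero {A : Type*} [CommRing A] (I : Ideal A) : Prop :=
  ∀ x ∈ I, ∀ y ∈ I, x * y = 0

/-- The Steenrod group `G_p(A,I)`: sequences `α : ℕ → A` with `α 0 - 1 ∈ I`. -/
def steenrodSet {A : Type*} [CommRing A] (I : Ideal A) : Set (ℕ → A) :=
  {α | α 0 - 1 ∈ I}

theorem seqMul_zero {A : Type*} [CommRing A] (p : ℕ) (α β : ℕ → A) :
    seqMul p α β 0 = α 0 * β 0 := by
  simp [seqMul]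

theorem seqMul_one {A : Type*} [CommRing A] (p : ℕ) (α β : ℕ → A) :
    seqMul p α β 1 = α 1 * β 0 + α 0 ^ p * β 1 := by
  simp [seqMul, Finset.sum_range_succ]

theorem seqMul_two {A : Type*} [CommRing A] (p : ℕ) (α β : ℕ → A) :
    seqMul p α β 2 = α 2 * β 0 + α 1 ^ p * β 1 + α 0 ^ p ^ 2 * β 2 := by
  simp [seqMul, Finset.sum_range_succ]

theorem IsSqZero.pow_char_eq_one {A : Type*} [CommRing A] {p : ℕ} (hp : p.Prime) [CharP A p]
    {I : Ideal A} (hI : IsSqZero I) {a : A} (ha : a - 1 ∈ I) : a ^ p = 1 := by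
  have := Fact.mk hp
  have hsq : (a - 1) ^ 2 = 0 := by rw [sq, hI _ ha _ ha]
  rw [← sub_eq_zero, ← one_pow (M := A) p, ← sub_pow_char]
  exact pow_eq_zero_of_le hp.two_le hsq

/-- The first coefficients of a right inverse, when the leading coefficient `α 0` has
`p`-th power `1`. -/
theorem coeffs_of_seqMul_eq_seqOne {A : Type*} [CommRing A] {p : ℕ} {α αb : ℕ → A}
    (h0 : α 0 ^ p = 1) (h : seqMul p α αb = seqOne) :
    α 0 * αb 0 = 1 ∧ αb 1 = -(α 1 * αb 0) ∧ αb 2 = (α 1 ^ p * α 1 - α 2) * αb 0 := by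
  have e0 := congrFun h 0
  have e1 := congrFun h 1
  have e2 := congrFun h 2
  have h0' : α 0 ^ p ^ 2 = 1 := by rw [sq, pow_mul, h0, one_pow]
  simp only [seqMul_zero, seqMul_one, seqMul_two, h0, h0', seqOne, if_true, one_ne_zero,
    two_ne_zero, if_false, one_mul] at e0 e1 e2
  refine ⟨e0, by linear_combination e1, by linear_combination e2 - α 1 ^ p * e1⟩

/-- Let `p` be a prime, `A` a commutative ring of characteristic `p`,
`I` a square-zero ideal of `A`, `α, β ∈ G_p(A,I)` with two-sided inverses `ᾱ, β̄`, and
let `γ = (ᾱ·β̄)·(α·β)` be their commutator.  Then `γ_0 = 1`,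
`γ_1 = α_1(β_0 − 1) + (1 − α_0)β_1`, and
`γ_2 = (α_2 − α_1^(p+1))(β_0 − 1) + (1 − α_0)(β_2 − β_1^(p+1)) + α_0·α_1^p·β_1 − α_1·β_0·β_1^p`. -/
theorem steenrod_commutator_coeffs {A : Type*} [CommRing A] (p : ℕ) (hp : p.Prime)
    [CharP A p] (I : Ideal A) (hI : IsSqZero I)
    (α β αb βb : ℕ → A)
    (hα : α ∈ steenrodSet I) (hβ : β ∈ steenrodSet I)
    (hαi : seqMul p α αb = seqOne) (hαi' : seqMul p αb α = seqOne)
    (hβi : seqMul p β βb = seqOne) (hβi' : seqMul p βb β = seqOne) :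
    seqMul p (seqMul p αb βb) (seqMul p α β) 0 = 1 ∧
    seqMul p (seqMul p αb βb) (seqMul p α β) 1
      = α 1 * (β 0 - 1) + (1 - α 0) * β 1 ∧
    seqMul p (seqMul p αb βb) (seqMul p α β) 2
      = (α 2 - α 1 ^ (p + 1)) * (β 0 - 1) + (1 - α 0) * (β 2 - β 1 ^ (p + 1))
        + α 0 * α 1 ^ p * β 1 - α 1 * β 0 * β 1 ^ p := by
  have := Fact.mk hp
  have ha := hI.pow_char_eq_one hp hα
  have hb := hI.pow_char_eq_one hp hβ
  obtain ⟨a0, a1, a2⟩ := coeffs_of_seqMul_eq_seqOne ha hαi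
  obtain ⟨b0, b1, b2⟩ := coeffs_of_seqMul_eq_seqOne hb hβi
  have hab : αb 0 ^ p = 1 := by
    simpa [mul_pow, ha] using congrArg (· ^ p) a0
  have hbb : βb 0 ^ p = 1 := by
    simpa [mul_pow, hb] using congrArg (· ^ p) b0
  have hneg (x : A) : (-x) ^ p = -x ^ p := by
    simpa [zero_pow hp.ne_zero] using sub_pow_char (x := (0 : A)) (y := x) (p := p)
  have hab2 : αb 0 ^ p ^ 2 = 1 := by rw [sq, pow_mul, hab, one_pow]
  have hbb2 : βb 0 ^ p ^ 2 = 1 := by rw [sq, pow_mul, hbb, one_pow]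
  have ha2 : α 0 ^ p ^ 2 = 1 := by rw [sq, pow_mul, ha, one_pow]
  simp only [seqMul_zero, seqMul_one, seqMul_two, mul_pow, add_pow_char, hneg, a1, a2, b1, b2,
    ha, ha2, hab, hab2, hbb, hbb2, one_mul, mul_one, pow_succ _ p]
  generalize α 1 ^ p = c
  generalize β 1 ^ p = d
  refine ⟨?_, ?_, ?_⟩
  · linear_combination β 0 * βb 0 * a0 + b0
  · linear_combination (-α 1 * β 0 * βb 0) * a0 - (α 1 + α 0 * β 1) * b0
  · linear_combination (c * α 1 - α 2) * β 0 * βb 0 * a0 +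
      (c * α 1 - α 2 + α 0 * (d * β 1 - β 2) + c * β 1 * α 0) * b0
end

section
/- For every integer n ≥ 0, the subset G_{p,n}(A,I) = {α ∈ G_p(A,I) : (α_i)^(p^(n−i+1)) = 0 for all 1 ≤ i ≤ n, and α_i = 0 for all i ≥ n+1} is a subgroup of G_p(A,I): it contains the identity δ, it is closed under the product, and it is closed under taking inverses. -/
/-- The finite subgroup `G_{p,n}(A,I)` of the Steenrod group: sequences
`α ∈ G_p(A,I)` with `(α_i)^(p^(n−i+1)) = 0` for `1 ≤ i ≤ n` and `α_i = 0` for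
`i ≥ n+1`. -/
def steenrodFinite {A : Type*} [CommRing A] (p n : ℕ) (I : Ideal A) : Set (ℕ → A) :=
  {α | α 0 - 1 ∈ I ∧ (∀ i : ℕ, 1 ≤ i → i ≤ n → α i ^ p ^ (n - i + 1) = 0) ∧
    ∀ i : ℕ, n + 1 ≤ i → α i = 0}

/-- The vanishing conditions defining `steenrodFinite`, put in a uniform way. -/
theorem mem_steenrodFinite_iff {A : Type*} [CommRing A] {p n : ℕ} {I : Ideal A} {α : ℕ → A}
    (hp : p ≠ 0) :
    α ∈ steenrodFinite p n I ↔
      α 0 - 1 ∈ I ∧ ∀ k e : ℕ, 1 ≤ k → n + 1 ≤ k + e → α k ^ p ^ e = 0 := by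
  constructor
  · rintro ⟨h0, hpow, hvan⟩
    refine ⟨h0, fun k e hk hke => ?_⟩
    rcases le_or_gt k n with hkn | hkn
    · exact pow_eq_zero_of_le (Nat.pow_le_pow_right (Nat.pos_of_ne_zero hp) (by omega))
        (hpow k hk hkn)
    · rw [hvan k hkn, zero_pow (pow_ne_zero _ hp)]
  · rintro ⟨h0, h⟩
    exact ⟨h0, fun i hi _ => h i _ hi (by omega),
      fun i hi => by simpa using h i 0 (by omega) (by omega)⟩

/-- If `α` lies in `G_{p,n}(A,I)`, only the top summand of `(α·β)_i` survives raising to the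
power `p^e` when `i + e > n`. -/
theorem seqMul_pow_eq {A : Type*} [CommRing A] {p n : ℕ} (hp : p.Prime) [CharP A p]
    {I : Ideal A} {α : ℕ → A} (hα : α ∈ steenrodFinite p n I) (β : ℕ → A) {i e : ℕ}
    (hie : n + 1 ≤ i + e) :
    seqMul p α β i ^ p ^ e = (α 0 ^ p ^ i) ^ p ^ e * β i ^ p ^ e := by
  have : Fact p.Prime := ⟨hp⟩
  have h := ((mem_steenrodFinite_iff hp.ne_zero).1 hα).2
  rw [seqMul, sum_pow_char_pow, Finset.sum_range_succ, Finset.sum_eq_zero, zero_add,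
    Nat.sub_self, mul_pow]
  intro j hj
  have hj' := Finset.mem_range.1 hj
  rw [mul_pow, ← pow_mul, ← pow_add, h (i - j) (j + e) (by omega) (by omega), zero_mul]


/-- Let `p` be a prime, `A` a commutative ring of characteristic `p`
and `I` a square-zero ideal of `A`.  For every `n ≥ 0` the subset `G_{p,n}(A,I)` is a
subgroup of `G_p(A,I)`: it contains the identity `δ`, is closed under the product, and
is closed under taking (two-sided) inverses. -/
theorem steenrodFinite_subgroup {A : Type*} [CommRing A] (p : ℕ) (hp : p.Prime)
    [CharP A p] (I : Ideal A) (hI : IsSqZero I) (n : ℕ) :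
    steenrodFinite p n I ⊆ steenrodSet I ∧
    seqOne ∈ steenrodFinite (A := A) p n I ∧
    (∀ α ∈ steenrodFinite p n I, ∀ β ∈ steenrodFinite p n I,
      seqMul p α β ∈ steenrodFinite p n I) ∧
    (∀ α ∈ steenrodFinite p n I, ∀ α' : ℕ → A,
      seqMul p α α' = seqOne → seqMul p α' α = seqOne →
        α' ∈ steenrodFinite p n I) := by
  have hmem {α : ℕ → A} := mem_steenrodFinite_iff (n := n) (I := I) (α := α) hp.ne_zero
  refine ⟨fun α hα => hα.1, ⟨by simp [seqOne], ?_, ?_⟩, ?_, ?_⟩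
  · intro i hi _
    rw [seqOne, if_neg (by omega), zero_pow (pow_ne_zero _ hp.ne_zero)]
  · intro i hi
    rw [seqOne, if_neg (by omega)]
  · intro α hα β hβ
    refine hmem.2 ⟨?_, fun k e hk hke => ?_⟩
    · have h : seqMul p α β 0 - 1 = (α 0 - 1) * β 0 + (β 0 - 1) := by
        simp [seqMul]
        ring
      rw [h]
      exact I.add_mem (I.mul_mem_right _ hα.1) hβ.1
    · rw [seqMul_pow_eq hp hα β hke, (hmem.1 hβ).2 k e hk hke, mul_zero]
  · intro α hα α' hαα' _
    have h0 : α 0 * α' 0 = 1 := by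
      simpa [seqMul, seqOne] using congrFun hαα' 0
    refine hmem.2 ⟨?_, fun k e hk hke => ?_⟩
    · have h : α' 0 - 1 = -((α 0 - 1) * α' 0) := by
        linear_combination h0
      rw [h]
      exact I.neg_mem (I.mul_mem_right _ hα.1)
    · have h := seqMul_pow_eq hp hα α' hke
      rw [hαα', seqOne, if_neg (by omega), zero_pow (pow_ne_zero _ hp.ne_zero)] at h
      have hu : IsUnit ((α 0 ^ p ^ k) ^ p ^ e) := ((IsUnit.of_mul_eq_one _ h0).pow _).pow _
      exact hu.mul_right_eq_zero.1 h.symm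
end

section
/- Let K = {α : ℕ → A : α_0 = 1 and (α_i)^p = 0 for all i ≥ 1}. Then K is a subgroup of G_p(A,I); for all α, β ∈ K one has (α·β)_0 = 1 and (α·β)_i = α_i + β_i for all i ≥ 1; in particular K is an abelian subgroup of G_p(A,I), isomorphic as a group to the additive group of sequences (x_i)_{i≥1} with x_i ∈ A and x_i^p = 0 under componentwise addition. -/
/-- The kernel `K = G_p^{ab}(A)` of `ρ_0`: sequences with `α_0 = 1` and `(α_i)^p = 0`
for all `i ≥ 1`. -/
def steenrodAbKernel {A : Type*} [CommRing A] (p : ℕ) : Set (ℕ → A) :=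
  {α | α 0 = 1 ∧ ∀ i : ℕ, 1 ≤ i → α i ^ p = 0}

/-- A member of the kernel acts on arbitrary sequences through its linear terms only. -/
theorem seqMul_apply_of_mem_steenrodAbKernel {A : Type*} [CommRing A] {p : ℕ} (hp : p ≠ 0)
    {α : ℕ → A} (hα : α ∈ steenrodAbKernel (A := A) p) (β : ℕ → A) {i : ℕ} (hi : 1 ≤ i) :
    seqMul p α β i = α i * β 0 + β i := by
  obtain ⟨n, rfl⟩ := Nat.exists_eq_add_of_le' hi
  have hmid : ∑ j ∈ Finset.range n, α (n + 1 - (j + 1)) ^ p ^ (j + 1) * β (j + 1) = 0 := by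
    refine Finset.sum_eq_zero fun j hj => ?_
    have hj' := Finset.mem_range.mp hj
    rw [pow_succ', pow_mul, hα.2 _ (by lia), zero_pow (pow_ne_zero j hp), zero_mul]
  simp only [seqMul]
  rw [Finset.sum_range_succ, Finset.sum_range_succ', hmid]
  simp [hα.1]

/-- Forgetting the constant leading term identifies the kernel with the sequences, indexed by
positive integers, of elements whose `p`-th power vanishes. -/
def steenrodAbKernelEquiv (A : Type*) [CommRing A] (p : ℕ) :
    steenrodAbKernel (A := A) p ≃
      {x : {i : ℕ // 1 ≤ i} → A | ∀ i : {i : ℕ // 1 ≤ i}, x i ^ p = 0} where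
  toFun α := ⟨fun i => α.1 i, fun i => α.2.2 i i.2⟩
  invFun x := ⟨fun i => if h : 1 ≤ i then x.1 ⟨i, h⟩ else 1, by simp, fun i hi => by
    simpa [hi] using x.2 ⟨i, hi⟩⟩
  left_inv α := by
    ext i
    rcases i with _ | i
    · simp [α.2.1]
    · simp
  right_inv x := by
    ext i
    simp [i.2]

/-- Let `p` be a prime, `A` a commutative ring of characteristic `p`,
`I` a square-zero ideal of `A`, and `K = {α : α_0 = 1 and (α_i)^p = 0 for i ≥ 1}`.
Then `K` is a subgroup of `G_p(A,I)`; for `α, β ∈ K` one has `(α·β)_0 = 1` and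
`(α·β)_i = α_i + β_i` for `i ≥ 1`; in particular `K` is abelian and is isomorphic, as a
group, to the additive group of sequences `(x_i)_{i≥1}` with `x_i ∈ A`, `x_i^p = 0`,
under componentwise addition. -/
theorem steenrodAbKernel_abelian {A : Type*} [CommRing A] (p : ℕ) (hp : p.Prime)
    [CharP A p] (I : Ideal A) (hI : IsSqZero I) :
    (steenrodAbKernel (A := A) p ⊆ steenrodSet I ∧
      seqOne ∈ steenrodAbKernel (A := A) p ∧
      (∀ α ∈ steenrodAbKernel (A := A) p, ∀ β ∈ steenrodAbKernel (A := A) p,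
        seqMul p α β ∈ steenrodAbKernel (A := A) p) ∧
      (∀ α ∈ steenrodAbKernel (A := A) p, ∀ α' : ℕ → A,
        seqMul p α α' = seqOne → seqMul p α' α = seqOne →
          α' ∈ steenrodAbKernel (A := A) p)) ∧
    (∀ α ∈ steenrodAbKernel (A := A) p, ∀ β ∈ steenrodAbKernel (A := A) p,
      seqMul p α β 0 = 1 ∧ ∀ i : ℕ, 1 ≤ i → seqMul p α β i = α i + β i) ∧
    (∀ α ∈ steenrodAbKernel (A := A) p, ∀ β ∈ steenrodAbKernel (A := A) p,
      seqMul p α β = seqMul p β α) ∧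
    ∃ e : steenrodAbKernel (A := A) p ≃
        {x : {i : ℕ // 1 ≤ i} → A | ∀ i : {i : ℕ // 1 ≤ i}, x i ^ p = 0},
      ∀ a b c : steenrodAbKernel (A := A) p,
        (c : ℕ → A) = seqMul p (a : ℕ → A) (b : ℕ → A) →
          (e c : {i : ℕ // 1 ≤ i} → A) = (e a : {i : ℕ // 1 ≤ i} → A) + e b := by
  have hzero : ∀ α ∈ steenrodAbKernel (A := A) p, ∀ β ∈ steenrodAbKernel (A := A) p,
      seqMul p α β 0 = 1 := fun α hα β hβ => by rw [seqMul_zero, hα.1, hβ.1, mul_one]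
  have hpos : ∀ α ∈ steenrodAbKernel (A := A) p, ∀ β ∈ steenrodAbKernel (A := A) p,
      ∀ i : ℕ, 1 ≤ i → seqMul p α β i = α i + β i := fun α hα β hβ i hi => by
    rw [seqMul_apply_of_mem_steenrodAbKernel hp.ne_zero hα β hi, hβ.1, mul_one]
  have : Fact p.Prime := ⟨hp⟩
  refine ⟨⟨fun α hα => ?_, ⟨by simp [seqOne], fun i hi => ?_⟩, fun α hα β hβ =>
    ⟨hzero α hα β hβ, fun i hi => ?_⟩, fun α hα α' h _ => ?_⟩,
    fun α hα β hβ => ⟨hzero α hα β hβ, hpos α hα β hβ⟩, fun α hα β hβ => ?_,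
    steenrodAbKernelEquiv A p, fun a b c h => ?_⟩
  · simp [steenrodSet, hα.1]
  · simp [seqOne, Nat.one_le_iff_ne_zero.mp hi, hp.ne_zero]
  · rw [hpos α hα β hβ i hi, add_pow_char, hα.2 i hi, hβ.2 i hi, add_zero]
  · have h0 : α' 0 = 1 := by
      simpa [seqMul_zero, hα.1, seqOne] using congrFun h 0
    refine ⟨h0, fun i hi => ?_⟩
    have hsum : α i + α' i = 0 := by
      simpa [seqMul_apply_of_mem_steenrodAbKernel hp.ne_zero hα α' hi, h0, seqOne,
        Nat.one_le_iff_ne_zero.mp hi] using congrFun h i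
    rw [eq_neg_of_add_eq_zero_right hsum, neg_pow, hα.2 i hi, mul_zero]
  · funext i
    rcases Nat.eq_zero_or_pos i with rfl | hi
    · rw [hzero α hα β hβ, hzero β hβ α hα]
    · rw [hpos α hα β hβ i hi, hpos β hβ α hα i hi, add_comm]
  · funext i
    exact (congrFun h i).trans (hpos a a.2 b b.2 i i.2)
end

section
/- Let p be a prime and R = MvPolynomial on variables X_1, X_2, X_3, … over ZMod p. Let μ : R → R ⊗ R be the unique ZMod p-algebra homomorphism with μ(X_n) = Σ_{j=0}^{n} (X_{n−j})^(p^j) ⊗ X_j for every n ≥ 1, with the convention X_0 = 1, and let τ : R ⊗ R → R ⊗ R be the linear map swapping the two tensor factors. Let J be the ideal of R generated by {(X_n)^p : n ≥ 1}. Suppose I is an ideal of R such that: I ⊆ J; μ(I) ⊆ I⊗R + R⊗I (I is a coideal, so that μ descends to R/I); and μ(r) − τ(μ(r)) ∈ I⊗R + R⊗I for every r ∈ R (the induced coproduct on R/I is cocommutative). Then I = J. -/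
open scoped TensorProduct

/-- The generators `X_n` for `n ≥ 1`, with the convention `X_0 = 1`. -/
noncomputable def Xe (p : ℕ) (n : ℕ) : MvPolynomial ℕ+ (ZMod p) :=
  if h : n = 0 then 1 else MvPolynomial.X ⟨n, Nat.pos_of_ne_zero h⟩

/-- Milnor's coproduct: the unique `ZMod p`-algebra homomorphism
`μ : R → R ⊗ R` with `μ(X_n) = ∑_{j=0}^{n} (X_{n−j})^(p^j) ⊗ X_j` (where `X_0 = 1`). -/
noncomputable def milnorCoproduct (p : ℕ) :
    MvPolynomial ℕ+ (ZMod p) →ₐ[ZMod p]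
      MvPolynomial ℕ+ (ZMod p) ⊗[ZMod p] MvPolynomial ℕ+ (ZMod p) :=
  MvPolynomial.aeval fun n : ℕ+ =>
    ∑ j ∈ Finset.range ((n : ℕ) + 1), ((Xe p ((n : ℕ) - j)) ^ (p ^ j)) ⊗ₜ[ZMod p] (Xe p j)

/-- The subspace `I ⊗ R + R ⊗ I` of `R ⊗ R`, as the `ZMod p`-span of the elementary
tensors with one factor in `I`. -/
noncomputable def coidealSpan (p : ℕ) (I : Ideal (MvPolynomial ℕ+ (ZMod p))) :
    Submodule (ZMod p)
      (MvPolynomial ℕ+ (ZMod p) ⊗[ZMod p] MvPolynomial ℕ+ (ZMod p)) :=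
  Submodule.span (ZMod p)
    {z | (∃ x ∈ I, ∃ r : MvPolynomial ℕ+ (ZMod p), z = x ⊗ₜ[ZMod p] r) ∨
         (∃ x ∈ I, ∃ r : MvPolynomial ℕ+ (ZMod p), z = r ⊗ₜ[ZMod p] x)}

lemma Xe_coe (p : ℕ) (n : ℕ+) : Xe p n = MvPolynomial.X n :=
  dif_neg n.ne_zero

/-- The coefficient of a monomial of degree one vanishes on powers `(X_n)^k` with `k ≠ 1`
(where `X_0 = 1`). -/
lemma coeff_single_one_Xe_pow (p n k : ℕ) (m : ℕ+) (h : n = 0 ∨ k ≠ 1 ∨ n ≠ m) :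
    MvPolynomial.coeff (Finsupp.single m 1) (Xe p n ^ k) = 0 := by
  classical
  rcases Nat.eq_zero_or_pos n with rfl | hn
  · rw [Xe, dif_pos rfl, one_pow, MvPolynomial.coeff_one, if_neg]
    exact fun h0 => one_ne_zero (Finsupp.single_eq_zero.mp h0.symm)
  · lift n to ℕ+ using hn
    rw [Xe_coe, MvPolynomial.coeff_X_pow, if_neg]
    intro h0
    rw [Finsupp.single_eq_single_iff] at h0
    rcases h0 with ⟨h1, h2⟩ | ⟨-, h2⟩
    · rcases h with h | h | h
      · exact n.ne_zero h
      · exact h h2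
      · exact h (congrArg PNat.val h1)
    · exact one_ne_zero h2

/-- The coefficient of a monomial of degree one vanishes on the ideal generated by the
`p`-th powers of the variables. -/
lemma coeff_single_one_eq_zero_of_mem {p : ℕ} (hp : p ≠ 1) (hp0 : p ≠ 0) (m : ℕ+)
    {f : MvPolynomial ℕ+ (ZMod p)}
    (hf : f ∈ Ideal.span {f : MvPolynomial ℕ+ (ZMod p) |
      ∃ n : ℕ+, f = MvPolynomial.X n ^ p}) :
    MvPolynomial.coeff (Finsupp.single m 1) f = 0 := by
  have hS : {f : MvPolynomial ℕ+ (ZMod p) | ∃ n : ℕ+, f = MvPolynomial.X n ^ p} =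
      (fun s => MvPolynomial.monomial s 1) '' Set.range fun n : ℕ+ => Finsupp.single n p := by
    ext f
    simp [MvPolynomial.X_pow_eq_monomial, eq_comm]
  rw [hS, MvPolynomial.mem_ideal_span_monomial_image] at hf
  by_contra hne
  obtain ⟨_, ⟨n, rfl⟩, hle⟩ := hf _ (MvPolynomial.mem_support_iff.mpr hne)
  have h := hle n
  rw [Finsupp.single_eq_same, Finsupp.single_apply] at h
  split_ifs at h <;> omega

/-- If a linear functional `φ` kills `I`, then `id ⊗ φ` maps `I ⊗ R + R ⊗ I` into `I`. -/
lemma rid_lTensor_mem_of_mem_coidealSpan {p : ℕ} {I : Ideal (MvPolynomial ℕ+ (ZMod p))}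
    (φ : MvPolynomial ℕ+ (ZMod p) →ₗ[ZMod p] ZMod p) (hφ : ∀ x ∈ I, φ x = 0)
    {z : MvPolynomial ℕ+ (ZMod p) ⊗[ZMod p] MvPolynomial ℕ+ (ZMod p)}
    (hz : z ∈ coidealSpan p I) :
    TensorProduct.rid (ZMod p) _ (φ.lTensor _ z) ∈ I := by
  induction hz using Submodule.span_induction with
  | zero => simp
  | add x y _ _ hx hy => simpa only [map_add] using I.add_mem hx hy
  | smul a x _ hx =>
    simpa only [map_smul, Submodule.restrictScalars_mem] using (I.restrictScalars (ZMod p)).smul_mem a hx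
  | mem x hx =>
    rcases hx with ⟨x, hx, r, rfl⟩ | ⟨x, hx, r, rfl⟩
    · simpa using (I.restrictScalars (ZMod p)).smul_mem (φ r) hx
    · simp [hφ x hx]

/-- Let `p` be a prime, `R = (ZMod p)[X₁, X₂, …]`, `μ` Milnor's
coproduct, `τ` the switch of the two tensor factors, and `J = ((Xₙ)^p : n ≥ 1)`.
If `I` is an ideal of `R` with `I ⊆ J` such that `μ(I) ⊆ I⊗R + R⊗I` and
`μ(r) − τ(μ(r)) ∈ I⊗R + R⊗I` for every `r ∈ R` (the induced coproduct on `R/I` is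
cocommutative), then `I = J`. -/
theorem minimal_cocommutative_hopf_ideal (p : ℕ) (hp : p.Prime)
    (I : Ideal (MvPolynomial ℕ+ (ZMod p)))
    (hIJ : I ≤ Ideal.span {f : MvPolynomial ℕ+ (ZMod p) |
        ∃ n : ℕ+, f = MvPolynomial.X n ^ p})
    (hcoideal : ∀ x ∈ I, milnorCoproduct p x ∈ coidealSpan p I)
    (hcocomm : ∀ r : MvPolynomial ℕ+ (ZMod p),
      milnorCoproduct p r -
          (Algebra.TensorProduct.comm (ZMod p) (MvPolynomial ℕ+ (ZMod p))
            (MvPolynomial ℕ+ (ZMod p))) (milnorCoproduct p r) ∈ coidealSpan p I) :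
    I = Ideal.span {f : MvPolynomial ℕ+ (ZMod p) | ∃ n : ℕ+, f = MvPolynomial.X n ^ p} := by
  refine le_antisymm hIJ (Ideal.span_le.mpr ?_)
  rintro _ ⟨m, rfl⟩
  let φ : MvPolynomial ℕ+ (ZMod p) →ₗ[ZMod p] ZMod p :=
    MvPolynomial.lcoeff (ZMod p) (Finsupp.single 1 1)
  have hφ (n k : ℕ) (h : n = 0 ∨ k ≠ 1 ∨ n ≠ 1) : φ (Xe p n ^ k) = 0 :=
    coeff_single_one_Xe_pow p n k 1 h
  have hφ₁ : φ (Xe p 1) = 1 := by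
    rw [← PNat.one_coe, Xe_coe]
    simp [φ]
  have hφI : ∀ x ∈ I, φ x = 0 := fun x hx =>
    coeff_single_one_eq_zero_of_mem hp.ne_one hp.ne_zero 1 (hIJ hx)
  have key := rid_lTensor_mem_of_mem_coidealSpan φ hφI (hcocomm (MvPolynomial.X (m + 1)))
  have hm : 0 < (m : ℕ) := m.pos
  have hleft : ∑ j ∈ Finset.range ((m : ℕ) + 1 + 1),
      φ (Xe p j) • Xe p ((m : ℕ) + 1 - j) ^ p ^ j = MvPolynomial.X m ^ p := by
    rw [Finset.sum_eq_single 1]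
    · simp [hφ₁, Xe_coe]
    · intro j _ hj
      rw [← pow_one (Xe p j), hφ j 1 (Or.inr (Or.inr hj)), zero_smul]
    · intro h
      exact absurd (Finset.mem_range.mpr (by omega)) h
  have hright : ∑ j ∈ Finset.range ((m : ℕ) + 1 + 1),
      φ (Xe p ((m : ℕ) + 1 - j) ^ p ^ j) • Xe p j = 0 := by
    refine Finset.sum_eq_zero fun j _ => ?_
    rw [hφ, zero_smul]
    rcases eq_or_ne j 0 with rfl | hj
    · exact Or.inr (Or.inr (by omega))
    · exact Or.inr (Or.inl (Nat.one_lt_pow hj hp.one_lt).ne')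
  simpa [milnorCoproduct, hleft, hright] using key
end
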